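/- Let 0 < c < √2 and let K : ℝ → ℝ be the inverse Fourier transform of ξ ↦ (1/√(2π)) · 1/(ξ⁴ - c²ξ² + 1). Then K together with its first three derivatives satisfies the exponential bound |K(x)| + |K'(x)| + |K''(x)| + |K'''(x)| ≤ C e^{-(√(2-c²)/2)|x|} for some constant C > 0. -/

import Mathlib

open MeasureTheory Real

noncomputable def gfun (s a P Q : ℝ) (x : ℝ) : ℝ :=
  Real.exp (s * x) * (P * Real.cos (a * x) + Q * Real.sin (a * x))

lemma gfun_deriv (s a P Q : ℝ) :
    deriv (gfun s a P Q) = gfun s a (s * P + a * Q) (s * Q - a * P) := by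
  funext x
  have h1 : HasDerivAt (fun x : ℝ => Real.exp (s * x)) (Real.exp (s * x) * (s * 1)) x :=
    ((hasDerivAt_id x).const_mul s).exp
  have h2 : HasDerivAt (fun x : ℝ => Real.cos (a * x)) (-Real.sin (a * x) * (a * 1)) x :=
    ((hasDerivAt_id x).const_mul a).cos
  have h3 : HasDerivAt (fun x : ℝ => Real.sin (a * x)) (Real.cos (a * x) * (a * 1)) x :=
    ((hasDerivAt_id x).const_mul a).sin
  have h := h1.mul ((h2.const_mul P).add (h3.const_mul Q))
  have h' : HasDerivAt (gfun s a P Q) _ x := h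
  rw [h'.deriv]
  simp only [gfun, Pi.add_apply]
  ring

lemma gfun_iter (s a P Q : ℝ) (n : ℕ) :
    ∃ P' Q', iteratedDeriv n (gfun s a P Q) = gfun s a P' Q' := by
  induction n with
  | zero => exact ⟨P, Q, by simp⟩
  | succ n ih =>
    obtain ⟨P', Q', h⟩ := ih
    exact ⟨_, _, by rw [iteratedDeriv_succ, h, gfun_deriv]⟩

lemma gfun_bound (s a P Q x : ℝ) : |gfun s a P Q x| ≤ (|P| + |Q|) * Real.exp (s * x) := by
  unfold gfun
  rw [abs_mul, abs_of_pos (Real.exp_pos _), mul_comm]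
  gcongr
  refine (abs_add_le _ _).trans ?_
  rw [abs_mul, abs_mul]
  have h1 := Real.abs_cos_le_one (a * x)
  have h2 := Real.abs_sin_le_one (a * x)
  have h3 := abs_nonneg P
  have h4 := abs_nonneg Q
  nlinarith

lemma iter_bound (b a P Q : ℝ) (K : ℝ → ℝ)
    (hK : ∀ x, K x = gfun (-b) a P Q |x|) (n : ℕ) :
    ∃ C > 0, ∀ x, |iteratedDeriv n K x| ≤ C * Real.exp (-b * |x|) := by
  obtain ⟨P1, Q1, h1⟩ := gfun_iter (-b) a P Q n
  obtain ⟨P2, Q2, h2⟩ := gfun_iter b a P (-Q) n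
  refine ⟨(|P1| + |Q1|) + (|P2| + |Q2|) + |iteratedDeriv n K 0| + 1, by positivity, fun x => ?_⟩
  rcases lt_trichotomy x 0 with hx | hx | hx
  · have he : K =ᶠ[nhds x] gfun b a P (-Q) := by
      filter_upwards [Iio_mem_nhds hx] with y hy
      rw [hK, abs_of_neg hy]
      simp [gfun]
    rw [he.iteratedDeriv_eq, h2, abs_of_neg hx]
    refine (gfun_bound _ _ _ _ _).trans ?_
    have : -b * -x = b * x := by ring
    rw [this]
    refine mul_le_mul_of_nonneg_right ?_ (Real.exp_pos _).le
    have := abs_nonneg P1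
    have := abs_nonneg Q1
    have := abs_nonneg (iteratedDeriv n K 0)
    have := abs_nonneg P1
    have := abs_nonneg Q1
    linarith
  · subst hx
    simp only [abs_zero, mul_zero, Real.exp_zero, mul_one]
    have := abs_nonneg P1
    have := abs_nonneg Q1
    have := abs_nonneg P2
    have := abs_nonneg Q2
    linarith
  · have he : K =ᶠ[nhds x] gfun (-b) a P Q := by
      filter_upwards [Ioi_mem_nhds hx] with y hy
      rw [hK, abs_of_pos hy]
    rw [he.iteratedDeriv_eq, h1, abs_of_pos hx]
    refine (gfun_bound _ _ _ _ _).trans ?_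
    refine mul_le_mul_of_nonneg_right ?_ (Real.exp_pos _).le
    have := abs_nonneg P1
    have := abs_nonneg Q1
    have := abs_nonneg (iteratedDeriv n K 0)
    have := abs_nonneg P2
    have := abs_nonneg Q2
    linarith

/-- Two-sided Laplace type integral. -/
lemma two_sided (z : ℂ) (hz : z.re < 0) (t : ℝ) :
    Integrable (fun v : ℝ => Complex.exp (-(t * v : ℂ) * Complex.I) * Complex.exp (z * (|v| : ℝ))) ∧
    ∫ v : ℝ, Complex.exp (-(t * v : ℂ) * Complex.I) * Complex.exp (z * (|v| : ℝ))
      = -2 * z / (z ^ 2 + t ^ 2) := by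
  have r1 : (z - t * Complex.I).re < 0 := by simpa using hz
  have r2 : 0 < (-z - t * Complex.I).re := by simpa using hz
  have e1 : Set.EqOn (fun v : ℝ => Complex.exp ((z - t * Complex.I) * v))
      (fun v : ℝ => Complex.exp (-(t * v : ℂ) * Complex.I) * Complex.exp (z * (|v| : ℝ)))
      (Set.Ioi 0) := by
    intro v hv
    simp only
    rw [abs_of_pos hv, ← Complex.exp_add]
    congr 1
    ring
  have e2 : Set.EqOn (fun v : ℝ => Complex.exp ((-z - t * Complex.I) * v))
      (fun v : ℝ => Complex.exp (-(t * v : ℂ) * Complex.I) * Complex.exp (z * (|v| : ℝ)))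
      (Set.Iic 0) := by
    intro v hv
    simp only
    rw [abs_of_nonpos hv, ← Complex.exp_add]
    congr 1
    push_cast
    ring
  have i1 := (integrableOn_exp_mul_complex_Ioi r1 0).congr_fun e1 measurableSet_Ioi
  have i2 := (integrableOn_exp_mul_complex_Iic r2 0).congr_fun e2 measurableSet_Iic
  constructor
  · rw [← integrableOn_univ, ← Set.Iic_union_Ioi (a := (0:ℝ))]
    exact i2.union i1
  · rw [← intervalIntegral.integral_Iic_add_Ioi i2 i1, ← setIntegral_congr_fun measurableSet_Ioi e1,
      ← setIntegral_congr_fun measurableSet_Iic e2, integral_exp_mul_complex_Ioi r1,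
      integral_exp_mul_complex_Iic r2]
    have n1 : z - t * Complex.I ≠ 0 := fun h => by rw [h] at r1; simp at r1
    have n2 : -z - t * Complex.I ≠ 0 := fun h => by rw [h] at r2; simp at r2
    have n3 : z ^ 2 + (t:ℂ) ^ 2 = -((z - t * Complex.I) * (-z - t * Complex.I)) := by
      linear_combination ((t:ℂ)^2) * Complex.I_sq
    rw [n3]
    simp only [Complex.ofReal_zero, mul_zero, Complex.exp_zero]
    field_simp
    ring

lemma symbol_integrable (c : ℝ) (h : c ^ 2 < 2) :
    Integrable (fun ξ : ℝ => 1 / (ξ ^ 4 - c ^ 2 * ξ ^ 2 + 1)) := by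
  have hd : 0 < (1 - c ^ 2 / 2) / 2 := by linarith
  have key : ∀ ξ : ℝ, (1 - c ^ 2 / 2) / 2 * (1 + ξ ^ 2) ≤ ξ ^ 4 - c ^ 2 * ξ ^ 2 + 1 := by
    intro ξ
    nlinarith [mul_nonneg (sq_nonneg c) (sq_nonneg (ξ ^ 2 - 1)), sq_nonneg (ξ ^ 2 - 1),
      mul_nonneg hd.le (sq_nonneg (2 * ξ ^ 2 - 1)), mul_nonneg hd.le (sq_nonneg (ξ ^ 2 )), hd]
  have hp : ∀ ξ : ℝ, 0 < ξ ^ 4 - c ^ 2 * ξ ^ 2 + 1 := fun ξ =>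
    lt_of_lt_of_le (by positivity) (key ξ)
  refine (integrable_inv_one_add_sq.const_mul ((1 - c ^ 2 / 2) / 2)⁻¹).mono'
    (Continuous.aestronglyMeasurable ?_) (Filter.Eventually.of_forall fun ξ => ?_)
  · exact Continuous.div (by fun_prop) (by fun_prop) fun ξ => (hp ξ).ne'
  · rw [Real.norm_of_nonneg (by have := hp ξ; positivity), ← mul_inv, one_div]
    exact inv_anti₀ (by positivity) (key ξ)

lemma inv_real (F : ℝ → ℂ) (x : ℝ) : FourierTransformInv.fourierInv F x =
    ∫ v : ℝ, Complex.exp (((2 * π * (v * x) : ℝ) : ℂ) * Complex.I) * F v := by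
  rw [Real.fourierInv_eq']
  simp [mul_comm]

lemma K_formula (c : ℝ) (hc0 : 0 < c) (h : c ^ 2 < 2)
    (K : ℝ → ℝ)
    (hK : ∀ x, K x = (1 / (2 * Real.pi)) *
      ∫ ξ : ℝ, Real.cos (x * ξ) / (ξ ^ 4 - c ^ 2 * ξ ^ 2 + 1)) :
    ∃ a P Q : ℝ, ∀ x, K x = gfun (-(Real.sqrt (2 - c ^ 2) / 2)) a P Q |x| := by
  obtain ⟨b, hb⟩ : ∃ b, b = Real.sqrt (2 - c ^ 2) / 2 := ⟨_, rfl⟩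
  obtain ⟨a, ha⟩ : ∃ a, a = Real.sqrt (2 + c ^ 2) / 2 := ⟨_, rfl⟩
  rw [← hb]
  have hb0 : 0 < b := by rw [hb]; have := Real.sqrt_pos.2 (sub_pos.2 h); positivity
  have ha0 : 0 < a := by rw [ha]; positivity
  have hb2 : b ^ 2 = (2 - c ^ 2) / 4 := by
    rw [hb, div_pow, Real.sq_sqrt (by linarith)]; norm_num
  have ha2 : a ^ 2 = (2 + c ^ 2) / 4 := by
    rw [ha, div_pow, Real.sq_sqrt (by positivity)]; norm_num
  clear ha hb
  have hb2' : (b:ℂ) ^ 2 = (2 - c ^ 2) / 4 := by exact_mod_cast congrArg Complex.ofReal hb2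
  have ha2' : (a:ℂ) ^ 2 = (2 + c ^ 2) / 4 := by exact_mod_cast congrArg Complex.ofReal ha2
  have hbC : (b:ℂ) ≠ 0 := by exact_mod_cast hb0.ne'
  have haC : (a:ℂ) ≠ 0 := by exact_mod_cast ha0.ne'
  obtain ⟨z, hz⟩ : ∃ z : ℂ, z = -b + a * Complex.I := ⟨_, rfl⟩
  obtain ⟨w, hw⟩ : ∃ w : ℂ, w = -b - a * Complex.I := ⟨_, rfl⟩
  have hzr : z.re < 0 := by simp [hz, hb0]
  have hwr : w.re < 0 := by simp [hw, hb0]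
  have hI := Complex.I_sq
  have hz2 : z ^ 2 = -c ^ 2 / 2 - 2 * a * b * Complex.I := by
    rw [hz]; linear_combination hb2' - ha2' + (a:ℂ) ^ 2 * hI
  have hw2 : w ^ 2 = -c ^ 2 / 2 + 2 * a * b * Complex.I := by
    rw [hw]; linear_combination hb2' - ha2' + (a:ℂ) ^ 2 * hI
  have hzw : z * w = 1 := by
    rw [hz, hw]; linear_combination hb2' + ha2' - (a:ℂ) ^ 2 * hI
  obtain ⟨p, hp⟩ : ∃ p : ℂ, p = Complex.I / (8 * a * b) * w := ⟨_, rfl⟩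
  obtain ⟨q, hq⟩ : ∃ q : ℂ, q = -Complex.I / (8 * a * b) * z := ⟨_, rfl⟩
  obtain ⟨f, hf⟩ : ∃ f : ℝ → ℂ, f = fun v => p * Complex.exp (z * (|v| : ℝ)) +
    q * Complex.exp (w * (|v| : ℝ)) := ⟨_, rfl⟩
  have hint := symbol_integrable c h
  have hDpos : ∀ t : ℝ, t ^ 4 - c ^ 2 * t ^ 2 + 1 ≠ 0 := by
    intro t
    have : 0 < t ^ 4 - c ^ 2 * t ^ 2 + 1 := by
      nlinarith [sq_nonneg (t ^ 2 - c ^ 2 / 2), sq_nonneg c, mul_pos (sub_pos.2 h) (sub_pos.2 h)]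
    exact this.ne'
  have hfc : Continuous f := by rw [hf]; fun_prop
  have hfi : Integrable f := by
    rw [hf]
    have := ((two_sided z hzr 0).1.const_mul p).add ((two_sided w hwr 0).1.const_mul q)
    simpa using! this
  have hFT : FourierTransform.fourier f =
      fun v : ℝ => ((1 / ((2 * π * v) ^ 4 - c ^ 2 * (2 * π * v) ^ 2 + 1) : ℝ) : ℂ) := by
    funext v
    rw [Real.fourier_real_eq_integral_exp_smul]
    obtain ⟨t, ht⟩ : ∃ t, t = 2 * π * v := ⟨_, rfl⟩
    have hcalc : (fun u : ℝ => Complex.exp (((-2 * π * u * v : ℝ) : ℂ) * Complex.I) • f u) =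
        fun u : ℝ => p * (Complex.exp (-(t * u : ℂ) * Complex.I) * Complex.exp (z * (|u| : ℝ))) +
          q * (Complex.exp (-(t * u : ℂ) * Complex.I) * Complex.exp (w * (|u| : ℝ))) := by
      funext u
      have : (((-2 * π * u * v : ℝ) : ℂ) * Complex.I) = -(t * u : ℂ) * Complex.I := by
        rw [ht]; push_cast; ring
      rw [this, hf, smul_eq_mul]
      ring
    rw [hcalc, integral_add ((two_sided z hzr t).1.const_mul p)
      ((two_sided w hwr t).1.const_mul q), integral_const_mul, integral_const_mul,
      (two_sided z hzr t).2, (two_sided w hwr t).2, ← ht]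
    have hD : (z ^ 2 + (t:ℂ) ^ 2) * (w ^ 2 + (t:ℂ) ^ 2) =
        ((t ^ 4 - c ^ 2 * t ^ 2 + 1 : ℝ) : ℂ) := by
      push_cast
      linear_combination (z * w + 1) * hzw + (t:ℂ) ^ 2 * (hz2 + hw2)
    have hDne : ((t ^ 4 - c ^ 2 * t ^ 2 + 1 : ℝ) : ℂ) ≠ 0 := by exact_mod_cast hDpos t
    have hne := hDne
    rw [← hD] at hne
    have n1 := left_ne_zero_of_mul hne
    have n2 := right_ne_zero_of_mul hne
    rw [Complex.ofReal_div, ← hD, Complex.ofReal_one, hp, hq]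
    have hd : w ^ 2 - z ^ 2 = 4 * a * b * Complex.I := by rw [hz2, hw2]; ring
    have e1 : Complex.I / (8 * a * b) * w * (-2 * z / (z ^ 2 + (t:ℂ) ^ 2)) =
        -Complex.I / (4 * a * b) / (z ^ 2 + (t:ℂ) ^ 2) := by
      have : Complex.I / (8 * a * b) * w * (-2 * z / (z ^ 2 + (t:ℂ) ^ 2)) =
        (z * w) * (-Complex.I / (4 * a * b) / (z ^ 2 + (t:ℂ) ^ 2)) := by
        field_simp
        ring
      rw [this, hzw, one_mul]
    have e2 : -Complex.I / (8 * a * b) * z * (-2 * w / (w ^ 2 + (t:ℂ) ^ 2)) =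
        Complex.I / (4 * a * b) / (w ^ 2 + (t:ℂ) ^ 2) := by
      have : -Complex.I / (8 * a * b) * z * (-2 * w / (w ^ 2 + (t:ℂ) ^ 2)) =
        (z * w) * (Complex.I / (4 * a * b) / (w ^ 2 + (t:ℂ) ^ 2)) := by
        field_simp
        ring
      rw [this, hzw, one_mul]
    rw [e1, e2]
    field_simp
    linear_combination (-Complex.I) * hd - 4 * a * b * hI
  have hFi : Integrable (FourierTransform.fourier f) := by
    rw [hFT]
    exact (hint.comp_mul_left' (R := 2 * π) (by positivity)).ofReal
  have hinv := hfc.fourierInv_fourier_eq hfi hFi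
  refine ⟨a, p.re + q.re, q.im - p.im, fun x => ?_⟩
  have hx := congrFun hinv x
  rw [inv_real, hFT] at hx
  have hre : (f x).re = gfun (-b) a (p.re + q.re) (q.im - p.im) |x| := by
    rw [hf, hz, hw]
    simp [gfun, Complex.exp_re, Complex.exp_im]
    ring
  rw [← hre, ← hx, hK]
  have hI2 : Integrable (fun v : ℝ => Complex.exp (((2 * π * (v * x) : ℝ) : ℂ) * Complex.I) *
      ((1 / ((2 * π * v) ^ 4 - c ^ 2 * (2 * π * v) ^ 2 + 1) : ℝ) : ℂ)) := by
    refine (hFT ▸ hFi).bdd_mul (c := 1) (Continuous.aestronglyMeasurable (by fun_prop)) ?_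
    exact Filter.Eventually.of_forall fun v => (Complex.norm_exp_ofReal_mul_I _).le
  have := integral_re hI2
  simp only [RCLike.re_to_complex] at this
  rw [← this]
  have e : (fun v : ℝ => (Complex.exp (((2 * π * (v * x) : ℝ) : ℂ) * Complex.I) *
      ((1 / ((2 * π * v) ^ 4 - c ^ 2 * (2 * π * v) ^ 2 + 1) : ℝ) : ℂ)).re) =
      fun v : ℝ => (fun ξ : ℝ => Real.cos (x * ξ) / (ξ ^ 4 - c ^ 2 * ξ ^ 2 + 1)) (2 * π * v) := by
    funext v
    rw [Complex.re_mul_ofReal, Complex.exp_ofReal_mul_I_re]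
    simp only
    rw [mul_one_div]
    congr 2
    ring
  rw [e, Measure.integral_comp_mul_left
    (fun ξ : ℝ => Real.cos (x * ξ) / (ξ ^ 4 - c ^ 2 * ξ ^ 2 + 1)) (2 * π)]
  rw [abs_of_pos (by positivity), smul_eq_mul, one_div]

/-- Exponential bounds for the Green's function `K` of `∂ₓ⁴ + c²∂ₓ² + 1` and its first
    three derivatives, for `0 < c < √2`. Here `K` is the inverse Fourier transform
    (with the `1/√(2π)` convention) of `ξ ↦ (1/√(2π)) (ξ⁴ - c²ξ² + 1)⁻¹`; since the
    symbol is even and real this is `K x = (1/(2π)) ∫ cos(xξ)/(ξ⁴ - c²ξ² + 1) dξ`. -/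
theorem stmt_15 (c : ℝ) (hc0 : 0 < c) (hc : c < Real.sqrt 2)
    (K : ℝ → ℝ)
    (hK : ∀ x, K x = (1 / (2 * Real.pi)) *
      ∫ ξ : ℝ, Real.cos (x * ξ) / (ξ ^ 4 - c ^ 2 * ξ ^ 2 + 1)) :
    ∃ C > 0, ∀ x : ℝ,
      |K x| + |iteratedDeriv 1 K x| + |iteratedDeriv 2 K x| + |iteratedDeriv 3 K x| ≤
        C * Real.exp (-(Real.sqrt (2 - c ^ 2) / 2) * |x|) := by
  have h : c ^ 2 < 2 := (Real.lt_sqrt hc0.le).1 hc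
  obtain ⟨a, P, Q, hF⟩ := K_formula c hc0 h K hK
  obtain ⟨C0, h0, H0⟩ := iter_bound _ a P Q K hF 0
  obtain ⟨C1, h1, H1⟩ := iter_bound _ a P Q K hF 1
  obtain ⟨C2, h2, H2⟩ := iter_bound _ a P Q K hF 2
  obtain ⟨C3, h3, H3⟩ := iter_bound _ a P Q K hF 3
  refine ⟨C0 + C1 + C2 + C3, by positivity, fun x => ?_⟩
  have := H0 x
  rw [iteratedDeriv_zero] at this
  have := H1 x
  have := H2 x
  have := H3 x
  rw [add_mul, add_mul, add_mul]
  linarith
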